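/- Let M_5 be the 5×5 complex circulant matrix with first row (4, 2, −2, −4, 0), i.e., (M_5)_{k,l} = m_{(l−k) mod 5} where (m_0,…,m_4) = (4, 2, −2, −4, 0). Then: (1) (1,1,1,1,1)·M_5 = 0; (2) the row vector Z_0 = (e^{2πik/5})_{0 ≤ k < 5} satisfies Z_0·M_5 = λ_0·Z_0 with λ_0 = (8cos(π/10) + 4cos(3π/10))·e^{−iπ/10}; (3) the row vector Z_1 = (e^{6πik/5})_{0 ≤ k < 5} satisfies Z_1·M_5 = λ_1·Z_1 with λ_1 = (8cos(3π/10) − 4cos(π/10))·e^{−3iπ/10}; and (4) |λ_0| > 1 and 0 < |λ_1| < 1. -/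

import Mathlib

/-- Powers of a fifth root of unity form a left eigenvector of the circulant matrix with first
row `(4, 2, -2, -4, 0)`. -/
lemma vecMul_circulant_of_pow_five_eq_one (M : Matrix (Fin 5) (Fin 5) ℂ)
    (hM : ∀ k l : Fin 5, M k l = ![4, 2, -2, -4, 0] (l - k)) {z : ℂ} (hz : z ^ 5 = 1) :
    Matrix.vecMul (fun k : Fin 5 => z ^ (k : ℕ)) M
      = (4 + 2 * z ^ 4 - 2 * z ^ 3 - 4 * z ^ 2) • (fun k : Fin 5 => z ^ (k : ℕ)) := by
  ext l
  simp only [Matrix.vecMul, dotProduct, Fin.sum_univ_five, hM, Pi.smul_apply, smul_eq_mul]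
  fin_cases l <;> simp [Fin.sub_def] <;> grind

lemma ofReal_cos_eq_exp (x : ℝ) :
    ((Real.cos x : ℝ) : ℂ) = (Complex.exp (x * Complex.I) + Complex.exp (-(x * Complex.I))) / 2 := by
  rw [Complex.ofReal_cos, Complex.cos, neg_mul]

lemma exp_pi_mul_I_div_ten_pow_ten :
    Complex.exp (Real.pi * Complex.I / 10) ^ 10 = -1 := by
  rw [← Complex.exp_nat_mul, ← Complex.exp_pi_mul_I]
  congr 1
  push_cast
  ring

lemma cos_pi_div_ten_sq : Real.cos (Real.pi / 10) ^ 2 = (5 + √5) / 8 := by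
  rw [Real.cos_sq, show 2 * (Real.pi / 10) = Real.pi / 5 by ring, Real.cos_pi_div_five]
  ring

lemma eight_cos_sub_four_cos :
    8 * Real.cos (3 * Real.pi / 10) - 4 * Real.cos (Real.pi / 10)
      = 4 * Real.cos (Real.pi / 10) * (√5 - 2) := by
  rw [show 3 * Real.pi / 10 = 3 * (Real.pi / 10) by ring, Real.cos_three_mul]
  linear_combination 32 * Real.cos (Real.pi / 10) * cos_pi_div_ten_sq

/-- the expansion matrix `M_5` of the Sub Rosa 5 substitution, the
circulant matrix with first row `(4, 2, −2, −4, 0)`, has the all-ones row vector,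
`Z_0 = (e^{2πik/5})_k` and `Z_1 = (e^{6πik/5})_k` as left eigenvectors with eigenvalues
`0`, `λ_0 = (8cos(π/10)+4cos(3π/10))e^{−iπ/10}` and
`λ_1 = (8cos(3π/10)−4cos(π/10))e^{−3iπ/10}` respectively, and `|λ_0| > 1`,
`0 < |λ_1| < 1`. -/
theorem subRosa5_matrix_eigenvalues (M : Matrix (Fin 5) (Fin 5) ℂ)
    (hM : ∀ k l : Fin 5, M k l = ![4, 2, -2, -4, 0] (l - k)) :
    Matrix.vecMul (fun _ : Fin 5 => (1 : ℂ)) M = 0 ∧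
    Matrix.vecMul (fun k : Fin 5 => Complex.exp (2 * (Real.pi : ℂ) * Complex.I * ((k : ℕ) : ℂ) / 5)) M
      = (((8 * Real.cos (Real.pi / 10) + 4 * Real.cos (3 * Real.pi / 10) : ℝ) : ℂ) *
            Complex.exp (-(Complex.I * (Real.pi : ℂ) / 10))) •
          (fun k : Fin 5 => Complex.exp (2 * (Real.pi : ℂ) * Complex.I * ((k : ℕ) : ℂ) / 5)) ∧
    Matrix.vecMul (fun k : Fin 5 => Complex.exp (6 * (Real.pi : ℂ) * Complex.I * ((k : ℕ) : ℂ) / 5)) M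
      = (((8 * Real.cos (3 * Real.pi / 10) - 4 * Real.cos (Real.pi / 10) : ℝ) : ℂ) *
            Complex.exp (-(3 * Complex.I * (Real.pi : ℂ) / 10))) •
          (fun k : Fin 5 => Complex.exp (6 * (Real.pi : ℂ) * Complex.I * ((k : ℕ) : ℂ) / 5)) ∧
    1 < ‖((8 * Real.cos (Real.pi / 10) + 4 * Real.cos (3 * Real.pi / 10) : ℝ) : ℂ) *
          Complex.exp (-(Complex.I * (Real.pi : ℂ) / 10))‖ ∧
    0 < ‖((8 * Real.cos (3 * Real.pi / 10) - 4 * Real.cos (Real.pi / 10) : ℝ) : ℂ) *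
          Complex.exp (-(3 * Complex.I * (Real.pi : ℂ) / 10))‖ ∧
    ‖((8 * Real.cos (3 * Real.pi / 10) - 4 * Real.cos (Real.pi / 10) : ℝ) : ℂ) *
          Complex.exp (-(3 * Complex.I * (Real.pi : ℂ) / 10))‖ < 1 := by
  have hw := exp_pi_mul_I_div_ten_pow_ten
  set w := Complex.exp (Real.pi * Complex.I / 10)
  have hw0 : w ≠ 0 := Complex.exp_ne_zero _
  have exp_eq (n : ℕ) (x : ℂ) (hx : x = n * (Real.pi * Complex.I / 10)) :
      Complex.exp x = w ^ n := by rw [hx, Complex.exp_nat_mul]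
  have exp_neg_eq (n : ℕ) (x : ℂ) (hx : x = -(n * (Real.pi * Complex.I / 10))) :
      Complex.exp x = (w ^ n)⁻¹ := by rw [hx, Complex.exp_neg, Complex.exp_nat_mul]
  have hc1 : ((Real.cos (Real.pi / 10) : ℝ) : ℂ) = (w ^ 1 + (w ^ 1)⁻¹) / 2 := by
    rw [ofReal_cos_eq_exp, exp_eq 1 _ (by push_cast; ring), exp_neg_eq 1 _ (by push_cast; ring)]
  have hc3 : ((Real.cos (3 * Real.pi / 10) : ℝ) : ℂ) = (w ^ 3 + (w ^ 3)⁻¹) / 2 := by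
    rw [ofReal_cos_eq_exp, exp_eq 3 _ (by push_cast; ring), exp_neg_eq 3 _ (by push_cast; ring)]
  have hcos_pos : 0 < Real.cos (Real.pi / 10) :=
    Real.cos_pos_of_mem_Ioo ⟨by linarith [Real.pi_pos], by linarith [Real.pi_pos]⟩
  have hcos3_pos : 0 < Real.cos (3 * Real.pi / 10) :=
    Real.cos_pos_of_mem_Ioo ⟨by linarith [Real.pi_pos], by linarith [Real.pi_pos]⟩
  have hcos_le := Real.cos_le_one (Real.pi / 10)
  have hsqrt_gt : 2 < √5 := Real.lt_sqrt_of_sq_lt (by norm_num)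
  have hsqrt_lt : √5 < 9 / 4 := (Real.sqrt_lt' (by norm_num)).2 (by norm_num)
  have norm_exp_one : ‖Complex.exp (-(Complex.I * (Real.pi : ℂ) / 10))‖ = 1 := by
    simp [Complex.norm_exp]
  have norm_exp_three : ‖Complex.exp (-(3 * Complex.I * (Real.pi : ℂ) / 10))‖ = 1 := by
    simp [Complex.norm_exp]
  have hpos : 0 < 4 * Real.cos (Real.pi / 10) * (√5 - 2) :=
    mul_pos (by positivity) (by linarith)
  refine ⟨?_, ?_, ?_, ?_, ?_, ?_⟩
  · have h := vecMul_circulant_of_pow_five_eq_one M hM (one_pow 5)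
    norm_num at h
    exact h
  · have hz : (fun k : Fin 5 => Complex.exp (2 * (Real.pi : ℂ) * Complex.I * ((k : ℕ) : ℂ) / 5))
        = fun k : Fin 5 => (w ^ 4) ^ (k : ℕ) := by
      ext k
      rw [← pow_mul]
      exact exp_eq _ _ (by push_cast; ring)
    rw [hz, vecMul_circulant_of_pow_five_eq_one M hM (by linear_combination (w ^ 10 - 1) * hw),
      exp_neg_eq 1 _ (by push_cast; ring)]
    congr 1
    rw [Complex.ofReal_add, Complex.ofReal_mul, Complex.ofReal_mul, hc1, hc3]
    push_cast
    field_simp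
    grind
  · have hz : (fun k : Fin 5 => Complex.exp (6 * (Real.pi : ℂ) * Complex.I * ((k : ℕ) : ℂ) / 5))
        = fun k : Fin 5 => (w ^ 12) ^ (k : ℕ) := by
      ext k
      rw [← pow_mul]
      exact exp_eq _ _ (by push_cast; ring)
    have hz5 : (w ^ 12) ^ 5 = 1 := by
      rw [← pow_mul, show 12 * 5 = 10 * 6 by norm_num, pow_mul, hw]
      norm_num
    rw [hz, vecMul_circulant_of_pow_five_eq_one M hM hz5, exp_neg_eq 3 _ (by push_cast; ring)]
    congr 1
    have hw12 : w ^ 12 = -w ^ 2 := by linear_combination w ^ 2 * hw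
    rw [hw12, Complex.ofReal_sub, Complex.ofReal_mul, Complex.ofReal_mul, hc1, hc3]
    push_cast
    field_simp
    grind
  · rw [norm_mul, norm_exp_one, mul_one, Complex.norm_real, Real.norm_of_nonneg (by positivity)]
    nlinarith [cos_pi_div_ten_sq]
  · rw [norm_mul, norm_exp_three, mul_one, Complex.norm_real, eight_cos_sub_four_cos,
      Real.norm_of_nonneg hpos.le]
    exact hpos
  · rw [norm_mul, norm_exp_three, mul_one, Complex.norm_real, eight_cos_sub_four_cos,
      Real.norm_of_nonneg hpos.le]
    nlinarith
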